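/- Assume [H2]. Then the nonlinear map F : D^{σ,p}(𝕋ⁿ) → L^p_0(𝕋ⁿ) defined by F(ψ) := ∇V·∇ψ + ΔV ψ − ∂_{x₁}(φ_ψ ψ) is well defined and locally Lipschitz continuous: for every ψ ∈ D^{σ,p}(𝕋ⁿ) there exist R > 0 and L > 0 such that for all ψ₁, ψ₂ in the W^{σ,p}-ball of radius R around ψ, ‖F(ψ₁) − F(ψ₂)‖_{L^p} ≤ L ‖ψ₁ − ψ₂‖_{W^{σ,p}}. -/

import Mathlib

open MeasureTheory ENNReal Set Filter

noncomputable section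

/-- Ambient space `ℝ × ℝ^m`: the universal cover of the torus `𝕋^{m+1}` (so `n = m + 1`). -/
abbrev Spc (m : ℕ) : Type := ℝ × (Fin m → ℝ)

/-- Unit cube in the last `m` coordinates: a fundamental domain for `𝕋^m`. -/
def cube1 (m : ℕ) : Set (Fin m → ℝ) := Set.pi Set.univ fun _ => Set.Ico (0 : ℝ) 1

/-- A fundamental domain for the torus `𝕋^{m+1}`. -/
def cube (m : ℕ) : Set (Spc m) := Set.Ico (0 : ℝ) 1 ×ˢ cube1 m

/-- The measure of the torus: Lebesgue measure restricted to a fundamental domain. -/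
def μT (m : ℕ) : Measure (Spc m) := volume.restrict (cube m)

/-- `ℤ^{m+1}`-periodicity: `f` is a function on the torus `𝕋^{m+1}`. -/
def IsPeriodic {m : ℕ} (f : Spc m → ℝ) : Prop :=
  ∀ (x : Spc m) (k : ℤ) (j : Fin m → ℤ), f (x.1 + k, fun i => x.2 i + j i) = f x

/-- The first coordinate direction. -/
def e1 (m : ℕ) : Spc m := (1, 0)

/-- The remaining coordinate directions. -/
def eC (m : ℕ) (i : Fin m) : Spc m := (0, Pi.single i 1)

/-- Partial derivative in the direction `v`. -/
def pd {m : ℕ} (v : Spc m) (f : Spc m → ℝ) (x : Spc m) : ℝ := fderiv ℝ f x v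

/-- `∇f ⋅ ∇g`. -/
def gradDot {m : ℕ} (f g : Spc m → ℝ) (x : Spc m) : ℝ :=
  pd (e1 m) f x * pd (e1 m) g x + ∑ i, pd (eC m i) f x * pd (eC m i) g x

/-- The Laplacian. -/
def lap {m : ℕ} (f : Spc m → ℝ) (x : Spc m) : ℝ :=
  pd (e1 m) (pd (e1 m) f) x + ∑ i, pd (eC m i) (pd (eC m i) f) x

/-- The marginal `ψ̄(x₁) = ∫_{𝕋^m} ψ(x₁, ⋅)`. -/
def marg {m : ℕ} (ψ : Spc m → ℝ) (x1 : ℝ) : ℝ := ∫ y in cube1 m, ψ (x1, y)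

/-- The nonlocal coefficient `φ_ψ = (∫ ∂_{x₁}V ψ dx₂…dxₙ) / ψ̄`. -/
def phiF {m : ℕ} (V ψ : Spc m → ℝ) (x1 : ℝ) : ℝ :=
  (∫ y in cube1 m, pd (e1 m) V (x1, y) * ψ (x1, y)) / marg ψ x1

/-- `F(ψ) = ∇V⋅∇ψ + ΔV ψ − ∂_{x₁}(φ_ψ ψ)`. -/
def Fop {m : ℕ} (V ψ : Spc m → ℝ) (x : Spc m) : ℝ :=
  gradDot V ψ x + lap V x * ψ x - pd (e1 m) (fun z => phiF V ψ z.1 * ψ z) x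

/-- `L^p`-norm on the torus. -/
def LpN {m : ℕ} (p : ℝ) (f : Spc m → ℝ) : ℝ≥0∞ := eLpNorm f (ENNReal.ofReal p) (μT m)

/-- Gagliardo (Sobolev–Slobodeckij) seminorm of fractional order `s`. -/
def gagl {m : ℕ} {F : Type*} [NormedAddCommGroup F] (s p : ℝ) (f : Spc m → F) : ℝ≥0∞ :=
  (∫⁻ x in cube m, ∫⁻ y in cube m,
      ENNReal.ofReal (‖f x - f y‖ ^ p / ‖x - y‖ ^ ((m : ℝ) + 1 + s * p))) ^ (1 / p)

/-- The differential of `f`. -/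
def grd {m : ℕ} (f : Spc m → ℝ) (x : Spc m) : Spc m →L[ℝ] ℝ := fderiv ℝ f x

/-- The `W^{σ,p}`-norm on the torus, for `0 ≤ σ ≤ 2`. -/
def WNorm {m : ℕ} (σ p : ℝ) (f : Spc m → ℝ) : ℝ≥0∞ :=
  if σ ≤ 0 then LpN p f
  else if σ < 1 then LpN p f + gagl σ p f
  else if σ < 2 then
    LpN p f + eLpNorm (fun x => ‖grd f x‖) (ENNReal.ofReal p) (μT m)
      + (if σ = 1 then 0 else gagl (σ - 1) p (grd f))
  else
    LpN p f + eLpNorm (fun x => ‖grd f x‖) (ENNReal.ofReal p) (μT m)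
      + eLpNorm (fun x => ‖iteratedFDeriv ℝ 2 f x‖) (ENNReal.ofReal p) (μT m)

/-- Membership in `W^{σ,p}(𝕋^{m+1})`, for `0 ≤ σ ≤ 2`. -/
def MemW {m : ℕ} (σ p : ℝ) (f : Spc m → ℝ) : Prop :=
  IsPeriodic f ∧ Measurable f ∧ (1 ≤ σ → Differentiable ℝ f) ∧
    (2 ≤ σ → Differentiable ℝ (grd f)) ∧ WNorm σ p f < ⊤

/-- Membership in `𝒟^{σ,p}(𝕋^{m+1}) = {ψ ∈ W^{σ,p} | ψ̄ > 0}`. -/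
def MemD {m : ℕ} (σ p : ℝ) (f : Spc m → ℝ) : Prop :=
  MemW σ p f ∧ ∀ x1 : ℝ, 0 < marg f x1

/-- Hypothesis `[H₁]`: `ψ₀ ∈ 𝒟^{σ,p}`, `ψ₀ ≥ 0`, `∫ ψ₀ = 1`. -/
def Hyp1 {m : ℕ} (σ p : ℝ) (ψ0 : Spc m → ℝ) : Prop :=
  MemD σ p ψ0 ∧ (∀ x, 0 ≤ ψ0 x) ∧ (∫ x in cube m, ψ0 x) = 1

/-- Hypothesis `[H₂]`: `n = m + 1 ≥ 2`, `p > n`, `σ ∈ (1 + n/p, 2)`. -/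
def Hyp2 (m : ℕ) (σ p : ℝ) : Prop :=
  1 ≤ m ∧ (m : ℝ) + 1 < p ∧ 1 + ((m : ℝ) + 1) / p < σ ∧ σ < 2

/-- The real interval `[0, Tmax)`, where `Tmax ∈ (0, ∞]`. -/
def Ico0 (Tmax : ℝ≥0∞) : Set ℝ := {t : ℝ | 0 ≤ t ∧ ENNReal.ofReal t < Tmax}

/-- The real interval `(0, Tmax)`, where `Tmax ∈ (0, ∞]`. -/
def Ioo0 (Tmax : ℝ≥0∞) : Set ℝ := {t : ℝ | 0 < t ∧ ENNReal.ofReal t < Tmax}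

/-- Continuity in `W^{σ,p}`-norm of a curve, on a time set `s`. -/
def ContW {m : ℕ} (σ p : ℝ) (s : Set ℝ) (ψ : ℝ → Spc m → ℝ) : Prop :=
  ∀ t ∈ s, ∀ ε : ℝ, 0 < ε → ∃ δ > 0, ∀ t' ∈ s, |t' - t| < δ →
    WNorm σ p (fun x => ψ t' x - ψ t x) < ENNReal.ofReal ε

/-- Hölder continuity (exponent `α`) in `W^{σ,p}`-norm of a curve, on a time set `s`. -/
def HolderW {m : ℕ} (α σ p : ℝ) (s : Set ℝ) (ψ : ℝ → Spc m → ℝ) : Prop :=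
  ∃ C : ℝ, ∀ t ∈ s, ∀ t' ∈ s,
    WNorm σ p (fun x => ψ t' x - ψ t x) ≤ ENNReal.ofReal (C * |t' - t| ^ α)

/-- `ψ` is an `L^p`-solution on `[0, Tmax)` of the nonlocal Fokker–Planck equation
`∂ₜψ = div(∇V ψ + β⁻¹∇ψ) − ∂_{x₁}(φ_ψ ψ) = β⁻¹Δψ + F(ψ)`, `ψ(0) = ψ₀`. -/
structure IsLpSolution {m : ℕ} (V : Spc m → ℝ) (β σ p : ℝ) (ψ0 : Spc m → ℝ)
    (Tmax : ℝ≥0∞) (ψ : ℝ → Spc m → ℝ) : Prop where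
  init : ∀ x, ψ 0 x = ψ0 x
  contLp : ContW 0 p (Ico0 Tmax) ψ
  regW2 : ∀ t ∈ Ioo0 Tmax, MemW 2 p (ψ t)
  regD : ∀ t ∈ Ioo0 Tmax, MemD σ p (ψ t)
  eqn : ∀ t ∈ Ioo0 Tmax,
    Tendsto (fun h : ℝ => LpN p
        (fun x => (ψ (t + h) x - ψ t x) / h - (β⁻¹ * lap (ψ t) x + Fop V (ψ t) x)))
      (nhdsWithin 0 {h : ℝ | h ≠ 0}) (nhds 0)
  derivCont : ContW 0 p (Ioo0 Tmax)
    (fun t x => β⁻¹ * lap (ψ t) x + Fop V (ψ t) x)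

/-- A maximal `L^p`-solution: an `L^p`-solution admitting no proper extension. -/
def IsMaximalLpSolution {m : ℕ} (V : Spc m → ℝ) (β σ p : ℝ) (ψ0 : Spc m → ℝ)
    (Tmax : ℝ≥0∞) (ψ : ℝ → Spc m → ℝ) : Prop :=
  IsLpSolution V β σ p ψ0 Tmax ψ ∧ 0 < Tmax ∧
    ∀ (Tmax' : ℝ≥0∞) (ψ' : ℝ → Spc m → ℝ), IsLpSolution V β σ p ψ0 Tmax' ψ' →
      (∀ t ∈ Ico0 Tmax, ψ' t = ψ t) → Tmax' ≤ Tmax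

/-- The Euclidean quadratic form on `Spc m`. -/
def qd {m : ℕ} (z : Spc m) : ℝ := z.1 ^ 2 + ∑ i, z.2 i ^ 2

/-- The heat semigroup `e^{β⁻¹ t Δ}` on the torus, realized by convolution with the Gaussian
heat kernel on the universal cover (and the identity for `t ≤ 0`). -/
def heatSG {m : ℕ} (β t : ℝ) (f : Spc m → ℝ) (x : Spc m) : ℝ :=
  if t ≤ 0 then f x
  else ∫ y : Spc m, (4 * Real.pi * (t / β)) ^ (-((m : ℝ) + 1) / 2) *
      Real.exp (-qd (x - y) / (4 * (t / β))) * f y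

/-- `ψ` is a mild solution of the nonlocal Fokker–Planck equation on `[0, Tmax)`:
`ψ ∈ C([0,Tmax), 𝒟^{σ,p})` and `ψ(t) = e^{β⁻¹tΔ}ψ₀ + ∫₀ᵗ e^{β⁻¹(t−s)Δ} F(ψ(s)) ds`. -/
def IsMildSolution {m : ℕ} (V : Spc m → ℝ) (β σ p : ℝ) (ψ0 : Spc m → ℝ)
    (Tmax : ℝ≥0∞) (ψ : ℝ → Spc m → ℝ) : Prop :=
  (∀ x, ψ 0 x = ψ0 x) ∧ (∀ t ∈ Ico0 Tmax, MemD σ p (ψ t)) ∧ ContW σ p (Ico0 Tmax) ψ ∧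
    ∀ t ∈ Ico0 Tmax, ∀ᵐ x ∂(volume : Measure (Spc m)),
      ψ t x = heatSG β t ψ0 x + ∫ s in Set.Ioc (0 : ℝ) t, heatSG β (t - s) (Fop V (ψ s)) x

/-- A maximal mild solution. -/
def IsMaximalMildSolution {m : ℕ} (V : Spc m → ℝ) (β σ p : ℝ) (ψ0 : Spc m → ℝ)
    (Tmax : ℝ≥0∞) (ψ : ℝ → Spc m → ℝ) : Prop :=
  IsMildSolution V β σ p ψ0 Tmax ψ ∧ 0 < Tmax ∧
    ∀ (Tmax' : ℝ≥0∞) (ψ' : ℝ → Spc m → ℝ), IsMildSolution V β σ p ψ0 Tmax' ψ' →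
      (∀ t ∈ Ico0 Tmax, ψ' t = ψ t) → Tmax' ≤ Tmax

/-- `L^p`-norm on the one-dimensional torus `𝕋`. -/
def LpN1 (p : ℝ) (g : ℝ → ℝ) : ℝ≥0∞ :=
  eLpNorm g (ENNReal.ofReal p) (volume.restrict (Set.Ico (0 : ℝ) 1))

/-- Membership in `L^p₀(𝕋^{m+1})`: periodic, `L^p` and of mean zero. -/
def MemL0 {m : ℕ} (p : ℝ) (f : Spc m → ℝ) : Prop :=
  IsPeriodic f ∧ Measurable f ∧ LpN p f < ⊤ ∧ (∫ x in cube m, f x) = 0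


lemma young_aux {t ε p : ℝ} (ht : 0 ≤ t) (hε : 0 < ε) (hp : 1 < p) :
    t ≤ ε + ε ^ (1 - p) * t ^ p := by
  have h0 : 0 ≤ ε ^ (1 - p) * t ^ p := by positivity
  rcases le_or_gt t ε with h | h
  · linarith
  · have ht' : 0 < t := hε.trans h
    have h1 : t ^ (1 - p) ≤ ε ^ (1 - p) :=
      Real.rpow_le_rpow_of_nonpos hε h.le (by linarith)
    have h2 : t = t ^ (1 - p) * t ^ p := by
      rw [← Real.rpow_add ht']; simp
    have h3 : t ^ (1 - p) * t ^ p ≤ ε ^ (1 - p) * t ^ p := by gcongr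
    linarith

lemma vol_ball (m : ℕ) (w : Spc m) {r : ℝ} (hr : 0 ≤ r) :
    volume (Metric.closedBall w r) = ENNReal.ofReal ((2 * r) ^ (m + 1)) := by
  obtain ⟨a, b⟩ := w
  rw [← closedBall_prod_same, Measure.volume_eq_prod, Measure.prod_prod, Real.volume_closedBall,
    Real.volume_pi_closedBall _ hr, ← ENNReal.ofReal_mul (by positivity)]
  simp [pow_succ, mul_comm]

/-- centers -/
def cen (m : ℕ) (x : Spc m) (k : ℕ) : Spc m :=
  (x.1 + (1/2 : ℝ) ^ k * (1/2 - x.1), fun i => x.2 i + (1/2 : ℝ) ^ k * (1/2 - x.2 i))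

def Qk (m : ℕ) (x : Spc m) (k : ℕ) : Set (Spc m) := Metric.closedBall (cen m x k) ((1/2 : ℝ) ^ k / 4)

lemma mem_closedBall_iff {m : ℕ} (y w : Spc m) {r : ℝ} (hr : 0 ≤ r) :
    y ∈ Metric.closedBall w r ↔ |y.1 - w.1| ≤ r ∧ ∀ i, |y.2 i - w.2 i| ≤ r := by
  rw [Metric.mem_closedBall, Prod.dist_eq, max_le_iff, dist_pi_le_iff hr]
  simp [Real.dist_eq]

lemma norm_le_iff {m : ℕ} (y w : Spc m) {r : ℝ} (hr : 0 ≤ r) :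
    ‖y - w‖ ≤ r ↔ |y.1 - w.1| ≤ r ∧ ∀ i, |y.2 i - w.2 i| ≤ r := by
  rw [← mem_closedBall_iff y w hr, Metric.mem_closedBall, dist_eq_norm]

lemma mem_cube_iff {m : ℕ} (y : Spc m) :
    y ∈ cube m ↔ (0 ≤ y.1 ∧ y.1 < 1) ∧ ∀ i, (0 ≤ y.2 i ∧ y.2 i < 1) := by
  simp [cube, cube1, Set.mem_prod, Set.mem_pi]

lemma half_pow_le (k : ℕ) : (1/2 : ℝ) ^ k ≤ 1 := pow_le_one₀ (by norm_num) (by norm_num)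

lemma coord_mem {x y r : ℝ} (hx : 0 ≤ x ∧ x < 1) (hr : 0 < r) (hr1 : r ≤ 1)
    (h : |y - (x + r * (1/2 - x))| ≤ r / 4) : 0 ≤ y ∧ y < 1 := by
  rw [abs_le] at h
  constructor
  · nlinarith [mul_nonneg hx.1 (sub_nonneg.2 hr1)]
  · nlinarith [mul_nonneg (sub_nonneg.2 hx.2.le) (sub_nonneg.2 hr1)]

lemma Qk_sub {m : ℕ} {x : Spc m} (hx : x ∈ cube m) (k : ℕ) : Qk m x k ⊆ cube m := by
  intro y hy
  have hr : (0:ℝ) < (1/2) ^ k := by positivity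
  rw [Qk, mem_closedBall_iff _ _ (by positivity)] at hy
  rw [mem_cube_iff] at hx ⊢
  exact ⟨coord_mem hx.1 hr (half_pow_le k) hy.1,
    fun i => coord_mem (hx.2 i) hr (half_pow_le k) (hy.2 i)⟩

lemma coord_dist {x y z r : ℝ} (hx : 0 ≤ x ∧ x < 1) (hr : 0 < r)
    (hz : |z - (x + r * (1/2 - x))| ≤ r / 4)
    (hy : |y - (x + (r / 2) * (1/2 - x))| ≤ (r / 2) / 4) : |z - y| ≤ r := by
  rw [abs_le] at *
  constructor <;> nlinarith [mul_nonneg hx.1 hr.le, mul_nonneg (sub_nonneg.2 hx.2.le) hr.le]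

lemma Qk_dist {m : ℕ} {x : Spc m} (hx : x ∈ cube m) (k : ℕ) {y z : Spc m}
    (hz : z ∈ Qk m x k) (hy : y ∈ Qk m x (k+1)) : ‖z - y‖ ≤ (1/2 : ℝ) ^ k := by
  have hr : (0:ℝ) < (1/2) ^ k := by positivity
  rw [Qk, mem_closedBall_iff _ _ (by positivity)] at hy hz
  rw [mem_cube_iff] at hx
  rw [norm_le_iff _ _ hr.le]
  have e : (1/2 : ℝ) ^ (k+1) = (1/2)^k / 2 := by rw [pow_succ]; ring
  simp only [cen, e] at hy hz
  exact ⟨coord_dist hx.1 hr hz.1 hy.1, fun i => coord_dist (hx.2 i) hr (hz.2 i) (hy.2 i)⟩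

lemma x_mem {m : ℕ} {x : Spc m} (hx : x ∈ cube m) (k : ℕ) :
    x ∈ Metric.closedBall (cen m x k) (2 * ((1/2 : ℝ) ^ k / 4)) := by
  have hr : (0:ℝ) < (1/2) ^ k := by positivity
  rw [mem_closedBall_iff _ _ (by positivity)]
  rw [mem_cube_iff] at hx
  have key : ∀ t : ℝ, 0 ≤ t ∧ t < 1 → |t - (t + (1/2:ℝ)^k * (1/2 - t))| ≤ 2 * ((1/2 : ℝ) ^ k / 4) := by
    intro t ht
    rw [abs_le]
    constructor <;> nlinarith [mul_nonneg ht.1 hr.le, mul_nonneg (sub_nonneg.2 ht.2.le) hr.le]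
  exact ⟨key _ hx.1, fun i => key _ (hx.2 i)⟩

lemma meas_cube (m : ℕ) : MeasurableSet (cube m) :=
  measurableSet_Ico.prod (MeasurableSet.univ_pi fun _ => measurableSet_Ico)

lemma vol_cube1 (m : ℕ) : volume (cube1 m) = 1 := by
  rw [cube1, Real.volume_pi_Ico]; simp

lemma vol_cube (m : ℕ) : volume (cube m) = 1 := by
  rw [cube, Measure.volume_eq_prod, Measure.prod_prod, vol_cube1]; simp

instance (m : ℕ) : IsProbabilityMeasure (μT m) := ⟨by simp [μT, vol_cube]⟩

/-- the one-step inequality -/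
lemma step_pt {F : Type*} [NormedAddCommGroup F] {m : ℕ} {p q ε r : ℝ} (hp : 1 < p) (hε : 0 < ε)
    (hq : 0 < q) (hr : 0 < r) (f : Spc m → F) {z y : Spc m} (h : ‖z - y‖ ≤ r) :
    ‖f y‖ₑ ≤ (‖f z‖ₑ + ENNReal.ofReal ε) + ENNReal.ofReal (ε ^ (1 - p) * r ^ q) *
      ENNReal.ofReal (‖f z - f y‖ ^ p / ‖z - y‖ ^ q) := by
  have h1 : ‖f y‖ ≤ ‖f z‖ + ‖f z - f y‖ := by
    have := norm_sub_norm_le (f y) (f z)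
    rw [norm_sub_rev] at this; linarith
  have h2 := young_aux (norm_nonneg (f z - f y)) hε hp
  have h3 : ‖f z - f y‖ ^ p ≤ r ^ q * (‖f z - f y‖ ^ p / ‖z - y‖ ^ q) := by
    rcases eq_or_ne z y with rfl | hzy
    · simp [Real.zero_rpow (by linarith : p ≠ 0)]
    · have : 0 < ‖z - y‖ := norm_pos_iff.2 (sub_ne_zero.2 hzy)
      have h4 : ‖z - y‖ ^ q ≤ r ^ q := Real.rpow_le_rpow this.le h hq.le
      have h5 : 0 < ‖z - y‖ ^ q := by positivity
      rw [mul_div_assoc', le_div_iff₀ h5, mul_comm]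
      gcongr
  rw [← ofReal_norm, ← ofReal_norm, ← ENNReal.ofReal_mul (by positivity),
    ← ENNReal.ofReal_add (by positivity) (by positivity),
    ← ENNReal.ofReal_add (by positivity) (by positivity)]
  apply ENNReal.ofReal_le_ofReal
  have h6 : 0 ≤ ε ^ (1 - p) := by positivity
  have := mul_le_mul_of_nonneg_left h3 h6
  rw [mul_assoc]
  linarith

lemma step_int {F : Type*} [NormedAddCommGroup F] {m : ℕ} {p q ε r : ℝ} (hp : 1 < p) (hε : 0 < ε)
    (hq : 0 < q) (hr : 0 < r) (f : Spc m → F) (hf : Measurable fun x => ‖f x‖ₑ)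
    (A B : Set (Spc m)) (hA : A ⊆ cube m) (hB : B ⊆ cube m) (hAm : MeasurableSet A)
    (hBm : MeasurableSet B) (h : ∀ z ∈ A, ∀ y ∈ B, ‖z - y‖ ≤ r) :
    volume A * ∫⁻ y in B, ‖f y‖ₑ ≤ volume B * (∫⁻ z in A, ‖f z‖ₑ) +
      ENNReal.ofReal ε * volume A * volume B +
      ENNReal.ofReal (ε ^ (1 - p) * r ^ q) * ∫⁻ x in cube m, ∫⁻ y in cube m,
        ENNReal.ofReal (‖f x - f y‖ ^ p / ‖x - y‖ ^ q) := by
  set c := ENNReal.ofReal (ε ^ (1 - p) * r ^ q)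
  have hc : c ≠ ⊤ := ENNReal.ofReal_ne_top
  set K : Spc m → Spc m → ℝ≥0∞ := fun x y => ENNReal.ofReal (‖f x - f y‖ ^ p / ‖x - y‖ ^ q)
  calc volume A * ∫⁻ y in B, ‖f y‖ₑ = ∫⁻ z in A, ∫⁻ y in B, ‖f y‖ₑ := by
        rw [setLIntegral_const, mul_comm]
    _ ≤ ∫⁻ z in A, ((‖f z‖ₑ + ENNReal.ofReal ε) * volume B + c * ∫⁻ y in B, K z y) := by
        refine setLIntegral_mono' hAm fun z hz => ?_
        calc ∫⁻ y in B, ‖f y‖ₑ ≤ ∫⁻ y in B, ((‖f z‖ₑ + ENNReal.ofReal ε) + c * K z y) :=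
              setLIntegral_mono' hBm fun y hy => step_pt hp hε hq hr f (h z hz y hy)
          _ = _ := by
              rw [lintegral_add_left measurable_const, lintegral_const_mul' _ _ hc,
                setLIntegral_const]
    _ = (∫⁻ z in A, ‖f z‖ₑ) * volume B + ENNReal.ofReal ε * volume A * volume B
          + c * ∫⁻ z in A, ∫⁻ y in B, K z y := by
        rw [lintegral_add_left ((hf.add_const _).mul_const _), lintegral_const_mul' _ _ hc,
          lintegral_mul_const _ (hf.add_const _), lintegral_add_left hf, setLIntegral_const, add_mul]
    _ ≤ _ := by
        rw [mul_comm (∫⁻ z in A, ‖f z‖ₑ)]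
        gcongr

lemma vol_Qk (m : ℕ) (x : Spc m) (k : ℕ) :
    volume (Qk m x k) = ENNReal.ofReal (((1/2 : ℝ) ^ k / 2) ^ (m + 1)) := by
  rw [Qk, vol_ball _ _ (by positivity)]
  congr 2; ring

lemma step_alg {m : ℕ} {p s T r : ℝ} (hp : 1 < p) (hT : 0 < T) (hr : 0 < r) :
    (T * r ^ (s - ((m:ℝ)+1)/p)) ^ (1 - p) * r ^ ((m:ℝ) + 1 + s * p) * T ^ p =
      8 ^ (m+1) * (T * r ^ (s - ((m:ℝ)+1)/p)) * ((r/2) ^ (m+1) * (r/2/2) ^ (m+1)) := by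
  have hp0 : p ≠ 0 := by linarith
  rw [Real.mul_rpow hT.le (by positivity), ← Real.rpow_mul hr.le]
  have e1 : T ^ (1 - p) * T ^ p = T := by rw [← Real.rpow_add hT]; simp
  have e2 : r ^ ((s - ((m:ℝ)+1)/p) * (1 - p)) * r ^ ((m:ℝ) + 1 + s * p) =
      r ^ (s - ((m:ℝ)+1)/p) * (r ^ (m+1) * r ^ (m+1)) := by
    rw [← Real.rpow_add hr, ← pow_add, ← Real.rpow_natCast, ← Real.rpow_add hr]
    congr 1
    push_cast
    field_simp
    ring
  have e3 : (8:ℝ) ^ (m+1) * ((r/2) ^ (m+1) * (r/2/2) ^ (m+1)) = r ^ (m+1) * r ^ (m+1) := by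
    rw [← mul_pow, ← mul_pow, ← mul_pow]; congr 1; ring
  calc _ = (T ^ (1 - p) * T ^ p) * (r ^ ((s - ((m:ℝ)+1)/p) * (1 - p)) * r ^ ((m:ℝ) + 1 + s * p)) := by
        ring
    _ = _ := by rw [e1, e2, ← e3]; ring

lemma avg_bound {F : Type*} [NormedAddCommGroup F] {m : ℕ} {p s T : ℝ} (hp : 1 < p) (hT : 0 < T)
    (hs : ((m:ℝ)+1)/p < s)
    (f : Spc m → F) (hf : Measurable fun x => ‖f x‖ₑ)
    (h1 : ∫⁻ y in cube m, ‖f y‖ₑ ≤ ENNReal.ofReal T)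
    (h2 : (∫⁻ x in cube m, ∫⁻ y in cube m,
        ENNReal.ofReal (‖f x - f y‖ ^ p / ‖x - y‖ ^ ((m:ℝ) + 1 + s * p))) ≤ ENNReal.ofReal (T ^ p))
    {x : Spc m} (hx : x ∈ cube m) (k : ℕ) :
    ∫⁻ y in Qk m x k, ‖f y‖ₑ ≤ ENNReal.ofReal (((1/2 : ℝ) ^ k / 2) ^ (m + 1) *
      (2 ^ (m+1) * T + ∑ j ∈ Finset.range k, (1 + 8 ^ (m+1)) *
        (T * ((1/2 : ℝ) ^ j) ^ (s - ((m:ℝ)+1)/p)))) := by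
  have hs0 : 0 < s := lt_trans (by positivity) hs
  induction k with
  | zero =>
    refine (lintegral_mono_set (Qk_sub hx 0)).trans (h1.trans ?_)
    apply ENNReal.ofReal_le_ofReal
    simp only [pow_zero, Finset.range_zero, Finset.sum_empty, add_zero, ← mul_assoc, ← mul_pow]
    norm_num
  | succ k ih =>
    set r : ℝ := (1/2 : ℝ) ^ k with hr_def
    have hr : 0 < r := by positivity
    have e : (1/2 : ℝ) ^ (k+1) = r / 2 := by rw [pow_succ]; ring
    set ε := T * r ^ (s - ((m:ℝ)+1)/p) with hε_def
    have hε : 0 < ε := by positivity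
    have hq : 0 < (m:ℝ) + 1 + s * p := by positivity
    have := step_int hp hε hq hr f hf (Qk m x k) (Qk m x (k+1)) (Qk_sub hx k) (Qk_sub hx (k+1))
      Metric.isClosed_closedBall.measurableSet Metric.isClosed_closedBall.measurableSet
      (fun z hz y hy => Qk_dist hx k hz hy)
    rw [vol_Qk, vol_Qk, e, ← hr_def] at this
    rw [e, Finset.sum_range_succ, ← hr_def, ← hε_def]
    set c := 2 ^ (m+1) * T + ∑ j ∈ Finset.range k, (1 + 8 ^ (m+1)) *
        (T * ((1/2 : ℝ) ^ j) ^ (s - ((m:ℝ)+1)/p)) with hc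
    have hc0 : 0 ≤ c := by positivity
    set v := (r / 2) ^ (m+1) with hv
    set v' := (r / 2 / 2) ^ (m+1) with hv'
    have hv0 : 0 < v := by positivity
    have hv0' : 0 < v' := by positivity
    have alg := step_alg (m := m) (s := s) hp hT hr
    rw [← hε_def, ← hv, ← hv'] at alg
    have h3 : ENNReal.ofReal v * ∫⁻ y in Qk m x (k+1), ‖f y‖ₑ ≤
        ENNReal.ofReal v * ENNReal.ofReal (v' * (2 ^ (m+1) * T + (∑ j ∈ Finset.range k, (1 + 8 ^ (m+1)) *
        (T * ((1/2 : ℝ) ^ j) ^ (s - ((m:ℝ)+1)/p)) + (1 + 8 ^ (m+1)) * ε))) := by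
      rw [← add_assoc, ← hc]
      calc _ ≤ _ := this
        _ ≤ ENNReal.ofReal v' * ENNReal.ofReal (v * c) + ENNReal.ofReal ε * ENNReal.ofReal v * ENNReal.ofReal v'
           + ENNReal.ofReal (ε ^ (1 - p) * r ^ ((m:ℝ) + 1 + s * p)) * ENNReal.ofReal (T ^ p) := by
            gcongr
        _ = _ := by
            rw [← ENNReal.ofReal_mul (by positivity), ← ENNReal.ofReal_mul (by positivity),
              ← ENNReal.ofReal_mul (by positivity), ← ENNReal.ofReal_mul (by positivity),
              ← ENNReal.ofReal_mul (by positivity), alg,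
              ← ENNReal.ofReal_add (by positivity) (by positivity),
              ← ENNReal.ofReal_add (by positivity) (by positivity)]
            congr 1; ring
    exact (ENNReal.mul_le_mul_iff_right (by simpa using hv0) ENNReal.ofReal_ne_top).1 h3

/-- the constant -/
def Cst (m : ℕ) (s p : ℝ) : ℝ :=
  2 ^ (m+1) + (1 + 8 ^ (m+1)) * (1 - (1/2 : ℝ) ^ (s - ((m:ℝ)+1)/p))⁻¹

lemma geo_bound {m : ℕ} {s p T : ℝ} (hT : 0 < T) (hs : ((m:ℝ)+1)/p < s) (k : ℕ) :
    2 ^ (m+1) * T + ∑ j ∈ Finset.range k, (1 + 8 ^ (m+1)) *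
        (T * ((1/2 : ℝ) ^ j) ^ (s - ((m:ℝ)+1)/p)) ≤ Cst m s p * T := by
  set α := s - ((m:ℝ)+1)/p with hα
  have hα0 : 0 < α := by linarith
  have h1 : (1/2 : ℝ) ^ α < 1 := Real.rpow_lt_one (by norm_num) (by norm_num) hα0
  have h0 : 0 ≤ (1/2 : ℝ) ^ α := by positivity
  have e : ∀ j : ℕ, ((1/2 : ℝ) ^ j) ^ α = ((1/2 : ℝ) ^ α) ^ j := by
    intro j
    rw [← Real.rpow_natCast, ← Real.rpow_natCast, ← Real.rpow_mul (by norm_num),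
      ← Real.rpow_mul (by norm_num), mul_comm]
  have h2 : ∑ j ∈ Finset.range k, ((1/2 : ℝ) ^ α) ^ j ≤ (1 - (1/2 : ℝ) ^ α)⁻¹ := by
    rw [← tsum_geometric_of_lt_one h0 h1]
    exact (summable_geometric_of_lt_one h0 h1).sum_le_tsum _ (fun i _ => by positivity)
  simp_rw [e, ← Finset.mul_sum]
  rw [Cst, ← hα, add_mul]
  have h3 : (1 + 8 ^ (m+1)) * (T * ∑ j ∈ Finset.range k, ((1/2 : ℝ) ^ α) ^ j) ≤
     (1 + 8 ^ (m+1)) * (T * (1 - (1/2 : ℝ) ^ α)⁻¹) := by gcongr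
  linarith

lemma Cst_pos {m : ℕ} {s p : ℝ} (hs : ((m:ℝ)+1)/p < s) : 0 < Cst m s p := by
  have := geo_bound (m := m) (T := 1) one_pos hs 0
  simp at this
  exact lt_of_lt_of_le (by positivity) this

lemma ess_bound {F : Type*} [NormedAddCommGroup F] {m : ℕ} {p s T : ℝ} (hp : 1 < p) (hT : 0 < T)
    (hs : ((m:ℝ)+1)/p < s)
    (f : Spc m → F) (hf : Measurable fun x => ‖f x‖ₑ)
    (h1 : ∫⁻ y in cube m, ‖f y‖ₑ ≤ ENNReal.ofReal T)
    (h2 : (∫⁻ x in cube m, ∫⁻ y in cube m,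
        ENNReal.ofReal (‖f x - f y‖ ^ p / ‖x - y‖ ^ ((m:ℝ) + 1 + s * p))) ≤ ENNReal.ofReal (T ^ p)) :
    ∀ᵐ x, x ∈ cube m → ‖f x‖ ≤ Cst m s p * T := by
  have hfin : (∫⁻ y, (cube m).indicator (fun x => ‖f x‖ₑ) y) ≠ ⊤ := by
    rw [lintegral_indicator (meas_cube m)]
    exact ne_top_of_le_ne_top ENNReal.ofReal_ne_top h1
  have hL := (IsUnifLocDoublingMeasure.vitaliFamily (volume : Measure (Spc m)) 2).ae_tendsto_lintegral_div'
    (hf.indicator (meas_cube m)) hfin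
  filter_upwards [hL] with x hx hxc
  have hδ : Tendsto (fun k : ℕ => (1/2 : ℝ) ^ k / 4) atTop (nhdsWithin 0 (Ioi 0)) := by
    rw [tendsto_nhdsWithin_iff]
    refine ⟨?_, Eventually.of_forall fun k => by simp⟩
    simpa using (tendsto_pow_atTop_nhds_zero_of_lt_one (r := (1/2:ℝ)) (by norm_num) (by norm_num)).div_const 4
  have ht := IsUnifLocDoublingMeasure.tendsto_closedBall_filterAt (volume : Measure (Spc m))
    (K := 2) (x := x) (cen m x) (fun k : ℕ => (1/2 : ℝ) ^ k / 4) hδ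
    (Eventually.of_forall fun k => x_mem hxc k)
  have hlim := hx.comp ht
  have hle : (cube m).indicator (fun x => ‖f x‖ₑ) x ≤ ENNReal.ofReal (Cst m s p * T) := by
    refine le_of_tendsto' hlim fun k => ?_
    have hv : 0 < ((1/2 : ℝ) ^ k / 2) ^ (m + 1) := by positivity
    change (∫⁻ y in Qk m x k, _) / volume (Qk m x k) ≤ _
    rw [vol_Qk]
    refine ENNReal.div_le_of_le_mul ?_
    calc ∫⁻ y in Qk m x k, (cube m).indicator (fun x => ‖f x‖ₑ) y
        ≤ ∫⁻ y in Qk m x k, ‖f y‖ₑ := lintegral_mono fun y => indicator_le_self _ _ _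
      _ ≤ _ := avg_bound hp hT hs f hf h1 h2 hxc k
      _ ≤ _ := by
        rw [← ENNReal.ofReal_mul' hv.le, mul_comm]
        apply ENNReal.ofReal_le_ofReal
        have := geo_bound (m := m) hT hs k
        gcongr
  rw [indicator_of_mem hxc, ← ofReal_norm] at hle
  exact (ENNReal.ofReal_le_ofReal_iff (mul_nonneg (Cst_pos hs).le hT.le)).1 hle

lemma exists_shift {m : ℕ} (x : Spc m) : ∃ y ∈ cube m, ∃ (k : ℤ) (j : Fin m → ℤ),
    x = (y.1 + k, fun i => y.2 i + j i) := by
  refine ⟨(Int.fract x.1, fun i => Int.fract (x.2 i)), ?_, ⌊x.1⌋, fun i => ⌊x.2 i⌋, ?_⟩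
  · rw [mem_cube_iff]
    exact ⟨⟨Int.fract_nonneg _, Int.fract_lt_one _⟩,
      fun i => ⟨Int.fract_nonneg _, Int.fract_lt_one _⟩⟩
  · ext <;> simp

lemma shift_eq {m : ℕ} (x : Spc m) (k : ℤ) (j : Fin m → ℤ) :
    ((x.1 + k, fun i => x.2 i + j i) : Spc m) = x + ((k : ℝ), fun i => (j i : ℝ)) := by
  ext <;> simp

lemma fderiv_per {m : ℕ} {f : Spc m → ℝ} (hf : IsPeriodic f) (x : Spc m) (k : ℤ) (j : Fin m → ℤ) :
    fderiv ℝ f (x.1 + k, fun i => x.2 i + j i) = fderiv ℝ f x := by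
  rw [shift_eq, ← fderiv_comp_add_right]
  congr 1
  funext y
  rw [← shift_eq]; exact hf y k j

lemma pd_per {m : ℕ} {f : Spc m → ℝ} (hf : IsPeriodic f) (v : Spc m) : IsPeriodic (pd v f) := by
  intro x k j
  simp only [pd, fderiv_per hf]

instance inst_right (m : ℕ) : (volume : Measure (Spc m)).IsAddRightInvariant := by
  have : (volume : Measure (Spc m)).IsAddLeftInvariant :=
    inferInstanceAs (((volume : Measure ℝ).prod (volume : Measure (Fin m → ℝ))).IsAddLeftInvariant)
  constructor
  intro g
  have h := map_add_left_eq_self (volume : Measure (Spc m)) g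
  simpa only [add_comm] using h

lemma ae_of_ae_cube {m : ℕ} {P : Spc m → Prop}
    (hper : ∀ (x : Spc m) (k : ℤ) (j : Fin m → ℤ), P x → P (x.1 + k, fun i => x.2 i + j i))
    (h : ∀ᵐ x, x ∈ cube m → P x) : ∀ᵐ x, P x := by
  have : ∀ᵐ x : Spc m, ∀ kj : ℤ × (Fin m → ℤ), (x + (((-kj.1 : ℤ) : ℝ), fun i => ((-kj.2 i : ℤ):ℝ))) ∈ cube m →
      P (x + (((-kj.1 : ℤ) : ℝ), fun i => ((-kj.2 i : ℤ):ℝ))) := by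
    rw [ae_all_iff]
    intro kj
    exact (measurePreserving_add_right (volume : Measure (Spc m)) _).quasiMeasurePreserving.ae h
  filter_upwards [this] with x hx
  obtain ⟨y, hy, k, j, rfl⟩ := exists_shift x
  have := hx (k, j)
  rw [shift_eq, add_assoc] at this
  have e : (((k:ℝ), fun i => (j i : ℝ)) : Spc m) + (((-k : ℤ) : ℝ), fun i => ((-j i : ℤ):ℝ)) = 0 := by
    ext <;> simp
  rw [e, add_zero] at this
  exact hper y k j (this hy)

lemma lip_of_ae {m : ℕ} {f : Spc m → ℝ} (hf : Differentiable ℝ f) {K : ℝ} 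
    (h : ∀ᵐ x, ‖fderiv ℝ f x‖ ≤ K) (x v : Spc m) : |f (x + v) - f x| ≤ K * ‖v‖ := by
  have hmeas : MeasurableSet {x : Spc m | ‖fderiv ℝ f x‖ ≤ K} :=
    measurableSet_le (measurable_fderiv ℝ f).norm measurable_const
  have h1 : ∀ᵐ t : ℝ, ∀ᵐ x : Spc m, ‖fderiv ℝ f (x + t • v)‖ ≤ K :=
    Eventually.of_forall fun t =>
      (measurePreserving_add_right (volume : Measure (Spc m)) _).quasiMeasurePreserving.ae h
  have h2 : ∀ᵐ x : Spc m, ∀ᵐ t : ℝ, ‖fderiv ℝ f (x + t • v)‖ ≤ K := by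
    refine (Measure.ae_ae_comm ?_).1 h1
    have : Measurable fun z : ℝ × Spc m => z.2 + z.1 • v := by fun_prop
    exact this hmeas
  have h3 : ∀ᵐ x : Spc m, |f (x + v) - f x| ≤ K * ‖v‖ := by
    filter_upwards [h2] with x hx
    have hd : ∀ t : ℝ, HasDerivAt (fun t : ℝ => f (x + t • v)) (fderiv ℝ f (x + t • v) v) t := by
      intro t
      have h4 : HasDerivAt (fun t : ℝ => x + t • v) v t := by
        simpa using ((hasDerivAt_id t).smul_const v).const_add x
      exact (hf _).hasFDerivAt.comp_hasDerivAt t h4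
    have hb : ∀ᵐ t : ℝ, ‖fderiv ℝ f (x + t • v) v‖ ≤ K * ‖v‖ := by
      filter_upwards [hx] with t ht
      exact (ContinuousLinearMap.le_opNorm _ _).trans (by gcongr)
    have hm : Measurable fun t : ℝ => fderiv ℝ f (x + t • v) v :=
      (measurable_fderiv_apply_const ℝ f v).comp (by fun_prop)
    have hi : IntervalIntegrable (fun t : ℝ => fderiv ℝ f (x + t • v) v) volume 0 1 :=
      (intervalIntegrable_const (c := K * ‖v‖)).mono_fun' hm.aestronglyMeasurable
        (ae_restrict_of_ae hb)
    have := intervalIntegral.integral_eq_sub_of_hasDerivAt (fun t _ => hd t) hi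
    simp only [one_smul, zero_smul, add_zero] at this
    rw [← this, ← Real.norm_eq_abs]
    simpa using intervalIntegral.norm_integral_le_of_norm_le_const_ae (a := 0) (b := 1)
      (hb.mono fun t ht _ => ht)
  have hd : Dense {x : Spc m | |f (x + v) - f x| ≤ K * ‖v‖} := Measure.dense_of_ae h3
  have hc : IsClosed {x : Spc m | |f (x + v) - f x| ≤ K * ‖v‖} := by
    have := hf.continuous
    exact isClosed_le (by fun_prop) continuous_const
  have := hc.closure_eq ▸ hd x
  exact this

lemma W_unfold {m : ℕ} {σ p : ℝ} (h2 : Hyp2 m σ p) (f : Spc m → ℝ) : WNorm σ p f =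
    LpN p f + eLpNorm (fun x => ‖grd f x‖) (ENNReal.ofReal p) (μT m) + gagl (σ - 1) p (grd f) := by
  obtain ⟨_, hp, h3, h4⟩ := h2
  have hp0 : 0 < p := lt_trans (by positivity) hp
  have : 0 < ((m : ℝ) + 1) / p := by positivity
  rw [WNorm, if_neg (by linarith), if_neg (by linarith), if_pos h4, if_neg (by linarith)]

lemma L1_le {F : Type*} [NormedAddCommGroup F] {m : ℕ} {p : ℝ} (hp : 1 < p) (f : Spc m → F)
    (hf : AEStronglyMeasurable f (μT m)) :
    ∫⁻ y in cube m, ‖f y‖ₑ ≤ eLpNorm f (ENNReal.ofReal p) (μT m) := by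
  have := eLpNorm_le_eLpNorm_of_exponent_le (p := 1) (q := ENNReal.ofReal p)
    (by simpa using hp.le) hf
  rwa [eLpNorm_one_eq_lintegral_enorm] at this

lemma key_T {m : ℕ} {σ p : ℝ} (h2 : Hyp2 m σ p) {f : Spc m → ℝ} (hf : MemW σ p f) {T : ℝ}
    (hT : 0 < T) (hW : WNorm σ p f ≤ ENNReal.ofReal T) (x : Spc m) :
    |f x| ≤ (Cst m (σ - 1) p + 1) * T ∧ ‖fderiv ℝ f x‖ ≤ (Cst m (σ - 1) p + 1) * T := by
  obtain ⟨h21, hp, h3, h4⟩ := id h2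
  have hp0 : 0 < p := lt_trans (by positivity) hp
  have hp1 : 1 < p := by
    have : (0:ℝ) ≤ m := by positivity
    linarith
  have hs : ((m:ℝ)+1)/p < σ - 1 := by linarith
  have hσ : 1 ≤ σ := by
    have : 0 < ((m : ℝ) + 1) / p := by positivity
    linarith
  have hd : Differentiable ℝ f := hf.2.2.1 hσ
  rw [W_unfold h2] at hW
  have hA : LpN p f ≤ ENNReal.ofReal T := le_trans (by rw [add_assoc]; exact le_self_add) hW
  have hB : eLpNorm (fun x => ‖grd f x‖) (ENNReal.ofReal p) (μT m) ≤ ENNReal.ofReal T :=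
    le_trans (le_trans le_add_self le_self_add) hW
  have hC : gagl (σ - 1) p (grd f) ≤ ENNReal.ofReal T := le_trans le_add_self hW
  have hCp := Cst_pos hs
  set C := Cst m (σ - 1) p with hCdef
  have hgm : Measurable (grd f) := measurable_fderiv ℝ f
  have hae : ∀ᵐ x, ‖fderiv ℝ f x‖ ≤ C * T := by
    refine ae_of_ae_cube (fun x k j hx => by rwa [fderiv_per hf.1]) ?_
    refine ess_bound hp1 hT hs (grd f) hgm.enorm ?_ ?_
    · have := L1_le hp1 (fun x => ‖grd f x‖) hgm.norm.aestronglyMeasurable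
      simp only [enorm_norm] at this
      exact this.trans hB
    · rw [gagl, one_div, ENNReal.rpow_inv_le_iff hp0, ENNReal.ofReal_rpow_of_pos hT] at hC
      exact hC
  have hlip := lip_of_ae hd hae
  constructor
  · obtain ⟨y, hy, k, j, rfl⟩ := exists_shift x
    rw [hf.1]
    have hL1 := (L1_le hp1 f hd.continuous.aestronglyMeasurable).trans hA
    have : ENNReal.ofReal |f y| ≤ ENNReal.ofReal ((C + 1) * T) := by
      calc ENNReal.ofReal |f y| = ∫⁻ z in cube m, ENNReal.ofReal |f y| := by
            rw [setLIntegral_const, vol_cube, mul_one]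
        _ ≤ ∫⁻ z in cube m, (ENNReal.ofReal (C * T) + ‖f z‖ₑ) := by
            refine setLIntegral_mono' (meas_cube m) fun z hz => ?_
            rw [← ofReal_norm, ← ENNReal.ofReal_add (by positivity) (by positivity)]
            apply ENNReal.ofReal_le_ofReal
            have h5 := hlip z (y - z)
            have h6 : ‖y - z‖ ≤ 1 := by
              rw [norm_le_iff _ _ zero_le_one]
              rw [mem_cube_iff] at hy hz
              refine ⟨?_, fun i => ?_⟩
              · rw [abs_le]; constructor <;> linarith [hy.1.1, hy.1.2, hz.1.1, hz.1.2]
              · rw [abs_le]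
                constructor <;> linarith [(hy.2 i).1, (hy.2 i).2, (hz.2 i).1, (hz.2 i).2]
            rw [add_sub_cancel] at h5
            have h7 : C * T * ‖y - z‖ ≤ C * T * 1 := by gcongr
            have h8 := abs_sub_abs_le_abs_sub (f y) (f z)
            rw [Real.norm_eq_abs]; linarith
        _ = ENNReal.ofReal (C * T) + ∫⁻ z in cube m, ‖f z‖ₑ := by
            rw [lintegral_add_left measurable_const, setLIntegral_const, vol_cube, mul_one]
        _ ≤ ENNReal.ofReal (C * T) + ENNReal.ofReal T := by gcongr
        _ = _ := by
            rw [← ENNReal.ofReal_add (by positivity) (by positivity)]; congr 1; ring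
    exact (ENNReal.ofReal_le_ofReal_iff (by positivity)).1 this
  · have hl : LipschitzWith (Real.toNNReal (C * T)) f := by
      refine LipschitzWith.of_dist_le_mul fun a b => ?_
      have := hlip b (a - b)
      rw [add_sub_cancel] at this
      rw [Real.coe_toNNReal _ (by positivity), Real.dist_eq, dist_eq_norm]
      exact this
    have := norm_fderiv_le_of_lipschitz ℝ (x₀ := x) hl
    rw [Real.coe_toNNReal _ (by positivity)] at this
    nlinarith

lemma key {m : ℕ} {σ p : ℝ} (h2 : Hyp2 m σ p) : ∃ C : ℝ, 0 < C ∧ ∀ f : Spc m → ℝ, MemW σ p f →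
    ∀ x, |f x| ≤ C * (WNorm σ p f).toReal ∧ ‖fderiv ℝ f x‖ ≤ C * (WNorm σ p f).toReal := by
  have hs : ((m:ℝ)+1)/p < σ - 1 := by linarith [h2.2.2.1]
  have hC := Cst_pos hs
  refine ⟨Cst m (σ - 1) p + 1, by positivity, fun f hf x => ?_⟩
  have hW := hf.2.2.2.2.ne
  set C := Cst m (σ - 1) p + 1 with hCd
  have hC0 : 0 < C := by positivity
  have h : ∀ ε : ℝ, 0 < ε → |f x| ≤ C * (WNorm σ p f).toReal + ε ∧
      ‖fderiv ℝ f x‖ ≤ C * (WNorm σ p f).toReal + ε := by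
    intro ε hε
    have h1 : 0 < (WNorm σ p f).toReal + ε / C := by positivity
    have := key_T h2 hf h1 (by
      rw [ENNReal.ofReal_add (by positivity) (by positivity), ENNReal.ofReal_toReal hW]
      exact le_self_add) x
    rw [← hCd, mul_add, mul_div_cancel₀ _ hC0.ne'] at this
    exact this
  exact ⟨le_of_forall_pos_le_add fun ε hε => (h ε hε).1,
    le_of_forall_pos_le_add fun ε hε => (h ε hε).2⟩

lemma per_bdd {E : Type*} [NormedAddCommGroup E] {m : ℕ} {g : Spc m → E} (hg : Continuous g)
    (hper : ∀ (x : Spc m) (k : ℤ) (j : Fin m → ℤ), g (x.1 + k, fun i => x.2 i + j i) = g x) :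
    ∃ A : ℝ, ∀ x, ‖g x‖ ≤ A := by
  obtain ⟨A, hA⟩ := (isCompact_Icc (a := (0 : Spc m)) (b := 1)).exists_bound_of_continuousOn
    hg.continuousOn
  refine ⟨A, fun x => ?_⟩
  obtain ⟨y, hy, k, j, rfl⟩ := exists_shift x
  rw [hper]
  rw [mem_cube_iff] at hy
  exact hA y ⟨⟨hy.1.1, fun i => (hy.2 i).1⟩, ⟨hy.1.2.le, fun i => (hy.2 i).2.le⟩⟩

structure Nice {m : ℕ} (B : ℝ) (f : Spc m → ℝ) : Prop where
  diff : Differentiable ℝ f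
  bd : ∀ x, |f x| ≤ B
  bd' : ∀ x, ‖fderiv ℝ f x‖ ≤ B

lemma norm_e1 (m : ℕ) : ‖e1 m‖ ≤ 1 := by simp [e1, Prod.norm_def]

lemma norm_eC (m : ℕ) (i : Fin m) : ‖eC m i‖ ≤ 1 := by
  simp [eC, Prod.norm_def, Pi.norm_single]

lemma Nice.nonneg {m : ℕ} {B : ℝ} {f : Spc m → ℝ} (h : Nice B f) : 0 ≤ B :=
  (abs_nonneg _).trans (h.bd 0)

lemma Nice.pd_le {m : ℕ} {B : ℝ} {f : Spc m → ℝ} (h : Nice B f) {v : Spc m} (hv : ‖v‖ ≤ 1)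
    (x : Spc m) : |pd v f x| ≤ B := by
  have h1 := (fderiv ℝ f x).le_opNorm v
  have h2 := h.bd' x
  have h3 : ‖fderiv ℝ f x‖ * ‖v‖ ≤ B * 1 := by
    have := h.nonneg
    gcongr
  rw [pd, ← Real.norm_eq_abs]; linarith

lemma Nice.mono {m : ℕ} {B B' : ℝ} {f : Spc m → ℝ} (h : Nice B f) (hB : B ≤ B') : Nice B' f :=
  ⟨h.diff, fun x => (h.bd x).trans hB, fun x => (h.bd' x).trans hB⟩

lemma Nice.mul {m : ℕ} {A B : ℝ} {f g : Spc m → ℝ} (hf : Nice A f) (hg : Nice B g) :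
    Nice (2 * A * B) (fun x => f x * g x) := by
  have hA := hf.nonneg
  have hB := hg.nonneg
  refine ⟨hf.diff.mul hg.diff, fun x => ?_, fun x => ?_⟩
  · rw [abs_mul]
    have : |f x| * |g x| ≤ A * B := mul_le_mul (hf.bd x) (hg.bd x) (abs_nonneg _) hA
    nlinarith [mul_nonneg hA hB]
  · rw [fderiv_fun_mul (hf.diff x) (hg.diff x)]
    refine (norm_add_le _ _).trans ?_
    rw [norm_smul, norm_smul, Real.norm_eq_abs, Real.norm_eq_abs]
    have h1 : |f x| * ‖fderiv ℝ g x‖ ≤ A * B := mul_le_mul (hf.bd x) (hg.bd' x) (norm_nonneg _) hA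
    have h2 : |g x| * ‖fderiv ℝ f x‖ ≤ B * A := mul_le_mul (hg.bd x) (hf.bd' x) (norm_nonneg _) hB
    linarith

lemma V_nice {m : ℕ} {V : Spc m → ℝ} (hV : ContDiff ℝ 2 V) (hVper : IsPeriodic V) (v : Spc m) :
    ∃ A : ℝ, Nice A (pd v V) := by
  have h1 : ContDiff ℝ 1 (pd v V) := by
    have : ContDiff ℝ 1 (fderiv ℝ V) := hV.fderiv_right (by norm_num)
    exact this.clm_apply contDiff_const
  have hper := pd_per hVper v
  obtain ⟨A, hA⟩ := per_bdd h1.continuous hper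
  obtain ⟨A', hA'⟩ := per_bdd (h1.continuous_fderiv one_ne_zero) (fderiv_per hper)
  exact ⟨max A A', h1.differentiable one_ne_zero, fun x => (hA x).trans (le_max_left _ _),
    fun x => (hA' x).trans (le_max_right _ _)⟩

lemma V_nice_all {m : ℕ} {V : Spc m → ℝ} (hV : ContDiff ℝ 2 V) (hVper : IsPeriodic V) :
    ∃ A : ℝ, Nice A (pd (e1 m) V) ∧ ∀ i, Nice A (pd (eC m i) V) := by
  obtain ⟨A, hA⟩ := V_nice hV hVper (e1 m)
  choose A' hA' using fun i => V_nice hV hVper (eC m i)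
  refine ⟨A + ∑ i, A' i, hA.mono ?_, fun i => (hA' i).mono ?_⟩
  · have : 0 ≤ ∑ i, A' i := Finset.sum_nonneg fun i _ => (hA' i).nonneg
    linarith
  · have := Finset.single_le_sum (f := A') (fun i _ => (hA' i).nonneg) (Finset.mem_univ i)
    linarith [hA.nonneg]

instance inst_prob1 (m : ℕ) : IsProbabilityMeasure ((volume : Measure (Fin m → ℝ)).restrict (cube1 m)) :=
  ⟨by simp [vol_cube1]⟩

lemma marg_abs_le {m : ℕ} {h : Spc m → ℝ} {B : ℝ} (hb : ∀ x, |h x| ≤ B) (t : ℝ) :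
    |marg h t| ≤ B := by
  rw [marg, ← Real.norm_eq_abs]
  have := norm_integral_le_of_norm_le_const (μ := (volume : Measure (Fin m → ℝ)).restrict (cube1 m))
    (f := fun y => h (t, y)) (C := B) (Eventually.of_forall fun y => hb (t, y))
  simpa using this

lemma slice_int {m : ℕ} {h : Spc m → ℝ} {B : ℝ} (hm : Measurable h) (hb : ∀ x, |h x| ≤ B) (t : ℝ) :
    Integrable (fun y => h (t, y)) ((volume : Measure (Fin m → ℝ)).restrict (cube1 m)) :=
  Integrable.of_bound (hm.comp measurable_prodMk_left).aestronglyMeasurable B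
    (Eventually.of_forall fun y => hb (t, y))

lemma marg_sub {m : ℕ} {h h' : Spc m → ℝ} {B : ℝ} (hm : Measurable h) (hb : ∀ x, |h x| ≤ B)
    (hm' : Measurable h') (hb' : ∀ x, |h' x| ≤ B) (t : ℝ) :
    marg h t - marg h' t = marg (fun x => h x - h' x) t :=
  (integral_sub (slice_int hm hb t) (slice_int hm' hb' t)).symm

lemma pd_meas {m : ℕ} (v : Spc m) (f : Spc m → ℝ) : Measurable (pd v f) :=
  measurable_fderiv_apply_const ℝ f v

lemma line_deriv {m : ℕ} {h : Spc m → ℝ} (hd : Differentiable ℝ h) (t : ℝ) (y : Fin m → ℝ) :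
    HasDerivAt (fun s => h (s, y)) (pd (e1 m) h (t, y)) t := by
  have h4 : HasDerivAt (fun s : ℝ => ((s, y) : Spc m)) (e1 m) t :=
    (hasDerivAt_id t).prodMk (hasDerivAt_const t y)
  exact (hd _).hasFDerivAt.comp_hasDerivAt t h4

lemma marg_deriv {m : ℕ} {h : Spc m → ℝ} {B : ℝ} (hh : Nice B h) (t : ℝ) :
    HasDerivAt (marg h) (marg (pd (e1 m) h) t) t := by
  have hm := hh.diff.continuous.measurable
  refine (hasDerivAt_integral_of_dominated_loc_of_deriv_le
    (μ := (volume : Measure (Fin m → ℝ)).restrict (cube1 m)) (F := fun t y => h (t, y))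
    (F' := fun t y => pd (e1 m) h (t, y)) (bound := fun _ => B) (s := univ) univ_mem ?_ ?_ ?_ ?_ ?_ ?_).2
  · exact Eventually.of_forall fun t => (slice_int hm hh.bd t).aestronglyMeasurable
  · exact slice_int hm hh.bd t
  · exact (slice_int (pd_meas _ h) (hh.pd_le (norm_e1 m)) t).aestronglyMeasurable
  · exact Eventually.of_forall fun y s _ => hh.pd_le (norm_e1 m) _
  · exact integrable_const _
  · exact Eventually.of_forall fun y s _ => line_deriv hh.diff s y

/-- bounded and Lipschitz pairs -/
def LB (E x y B L : ℝ) : Prop := |x| ≤ B ∧ |y| ≤ B ∧ |x - y| ≤ L * E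

lemma LB.add {E x y B L x' y' B' L' : ℝ} (h : LB E x y B L) (h' : LB E x' y' B' L') :
    LB E (x + x') (y + y') (B + B') (L + L') := by
  obtain ⟨h1, h2, h3⟩ := h
  obtain ⟨h1', h2', h3'⟩ := h'
  refine ⟨(abs_add_le _ _).trans (by linarith), (abs_add_le _ _).trans (by linarith), ?_⟩
  have := abs_add_le (x - y) (x' - y')
  rw [show x + x' - (y + y') = (x - y) + (x' - y') by ring]
  linarith

lemma LB.neg {E x y B L : ℝ} (h : LB E x y B L) : LB E (-x) (-y) B L := by
  refine ⟨by simpa using h.1, by simpa using h.2.1, ?_⟩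
  rw [show -x - -y = -(x - y) by ring, abs_neg]; exact h.2.2

lemma LB.sub {E x y B L x' y' B' L' : ℝ} (h : LB E x y B L) (h' : LB E x' y' B' L') :
    LB E (x - x') (y - y') (B + B') (L + L') := by
  rw [sub_eq_add_neg, sub_eq_add_neg]; exact h.add h'.neg

lemma LB.mul {E x y B L x' y' B' L' : ℝ} (h : LB E x y B L) (h' : LB E x' y' B' L') :
    LB E (x * x') (y * y') (B * B') (B * L' + L * B') := by
  obtain ⟨h1, h2, h3⟩ := h
  obtain ⟨h1', h2', h3'⟩ := h'
  have hB : 0 ≤ B := (abs_nonneg _).trans h1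
  refine ⟨by rw [abs_mul]; exact mul_le_mul h1 h1' (abs_nonneg _) hB,
    by rw [abs_mul]; exact mul_le_mul h2 h2' (abs_nonneg _) hB, ?_⟩
  rw [show x * x' - y * y' = x * (x' - y') + (x - y) * y' by ring]
  refine (abs_add_le _ _).trans ?_
  rw [abs_mul, abs_mul]
  have a1 : |x| * |x' - y'| ≤ B * (L' * E) := mul_le_mul h1 h3' (abs_nonneg _) hB
  have a2 : |x - y| * |y'| ≤ (L * E) * B' :=
    mul_le_mul h3 h2' (abs_nonneg _) ((abs_nonneg _).trans h3)
  linarith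

lemma LB.inv {E x y B L δ : ℝ} (h : LB E x y B L) (hδ : 0 < δ) (hx : δ ≤ x) (hy : δ ≤ y) :
    LB E x⁻¹ y⁻¹ δ⁻¹ (L * (δ⁻¹ * δ⁻¹)) := by
  have hx0 : 0 < x := hδ.trans_le hx
  have hy0 : 0 < y := hδ.trans_le hy
  have ix : |x⁻¹| ≤ δ⁻¹ := by
    rw [abs_of_pos (by positivity)]; exact inv_anti₀ hδ hx
  have iy : |y⁻¹| ≤ δ⁻¹ := by
    rw [abs_of_pos (by positivity)]; exact inv_anti₀ hδ hy
  refine ⟨ix, iy, ?_⟩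
  have e : x⁻¹ - y⁻¹ = -((x - y) * (x⁻¹ * y⁻¹)) := by field_simp; ring
  rw [e, abs_neg, abs_mul, abs_mul]
  have := mul_le_mul h.2.2 (mul_le_mul ix iy (abs_nonneg _) (by positivity))
    (by positivity) ((abs_nonneg _).trans h.2.2)
  linarith

lemma LB.const {E c B : ℝ} (h : |c| ≤ B) : LB E c c B 0 := ⟨h, h, by simp⟩

lemma LB.sum {m : ℕ} {E B L : ℝ} {x y : Fin m → ℝ} (h : ∀ i, LB E (x i) (y i) B L) :
    LB E (∑ i, x i) (∑ i, y i) (m * B) (m * L) := by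
  have key : ∀ (z : Fin m → ℝ) (c : ℝ), (∀ i, |z i| ≤ c) → |∑ i, z i| ≤ m * c := by
    intro z c hz
    refine (Finset.abs_sum_le_sum_abs _ _).trans ?_
    refine (Finset.sum_le_sum fun i _ => hz i).trans ?_
    simp
  refine ⟨key _ _ fun i => (h i).1, key _ _ fun i => (h i).2.1, ?_⟩
  rw [← Finset.sum_sub_distrib, mul_assoc]
  exact key _ _ fun i => (h i).2.2

lemma pd_sub {m : ℕ} {f g : Spc m → ℝ} (hf : Differentiable ℝ f) (hg : Differentiable ℝ g)
    (v x : Spc m) : pd v (fun x => f x - g x) x = pd v f x - pd v g x := by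
  simp only [pd]
  rw [fderiv_fun_sub (hf x) (hg x)]; rfl

lemma pd_LB {m : ℕ} {E B L : ℝ} {f g : Spc m → ℝ} (hf : Nice B f) (hg : Nice B g)
    (hd : Nice (L * E) (fun x => f x - g x)) {v : Spc m} (hv : ‖v‖ ≤ 1) (x : Spc m) :
    LB E (pd v f x) (pd v g x) B L := by
  refine ⟨hf.pd_le hv x, hg.pd_le hv x, ?_⟩
  rw [← pd_sub hf.diff hg.diff]; exact hd.pd_le hv x

lemma val_LB {m : ℕ} {E B L : ℝ} {f g : Spc m → ℝ} (hf : Nice B f) (hg : Nice B g)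
    (hd : Nice (L * E) (fun x => f x - g x)) (x : Spc m) :
    LB E (f x) (g x) B L := ⟨hf.bd x, hg.bd x, hd.bd x⟩

lemma marg_LB {m : ℕ} {E B L : ℝ} {f g : Spc m → ℝ} (hf : Nice B f) (hg : Nice B g)
    (hd : Nice (L * E) (fun x => f x - g x)) (t : ℝ) :
    LB E (marg f t) (marg g t) B L := by
  refine ⟨marg_abs_le hf.bd t, marg_abs_le hg.bd t, ?_⟩
  rw [marg_sub hf.diff.continuous.measurable hf.bd hg.diff.continuous.measurable hg.bd]
  exact marg_abs_le hd.bd t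

lemma marg_pd_LB {m : ℕ} {E B L : ℝ} {f g : Spc m → ℝ} (hf : Nice B f) (hg : Nice B g)
    (hd : Nice (L * E) (fun x => f x - g x)) (t : ℝ) :
    LB E (marg (pd (e1 m) f) t) (marg (pd (e1 m) g) t) B L := by
  have hf' := hf.pd_le (norm_e1 m)
  have hg' := hg.pd_le (norm_e1 m)
  refine ⟨marg_abs_le hf' t, marg_abs_le hg' t, ?_⟩
  rw [marg_sub (pd_meas _ f) hf' (pd_meas _ g) hg']
  refine marg_abs_le (fun x => ?_) t
  rw [← pd_sub hf.diff hg.diff]; exact hd.pd_le (norm_e1 m) x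

lemma phi_deriv {m : ℕ} {A B : ℝ} {V ψ : Spc m → ℝ} (hV : Nice A (pd (e1 m) V)) (hψ : Nice B ψ)
    {t : ℝ} (ht : marg ψ t ≠ 0) :
    HasDerivAt (phiF V ψ) ((marg (pd (e1 m) (fun x => pd (e1 m) V x * ψ x)) t * marg ψ t -
      marg (fun x => pd (e1 m) V x * ψ x) t * marg (pd (e1 m) ψ) t) / (marg ψ t) ^ 2) t :=
  (marg_deriv (hV.mul hψ) t).div (marg_deriv hψ t) ht

lemma phi_mul_fderiv {m : ℕ} {V ψ : Spc m → ℝ} {x : Spc m} {d : ℝ}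
    (hφ : HasDerivAt (phiF V ψ) d x.1) (hψ : Differentiable ℝ ψ) :
    HasFDerivAt (fun z : Spc m => phiF V ψ z.1 * ψ z)
      (phiF V ψ x.1 • fderiv ℝ ψ x + ψ x • (d • ContinuousLinearMap.fst ℝ ℝ (Fin m → ℝ))) x := by
  have h1 : HasFDerivAt (fun z : Spc m => phiF V ψ z.1)
      (d • ContinuousLinearMap.fst ℝ ℝ (Fin m → ℝ)) x :=
    hφ.comp_hasFDerivAt x hasFDerivAt_fst
  exact h1.mul (hψ x).hasFDerivAt

lemma Fop_eq {m : ℕ} {A B : ℝ} {V ψ : Spc m → ℝ} (hV : Nice A (pd (e1 m) V)) (hψ : Nice B ψ)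
    (x : Spc m) (ht : marg ψ x.1 ≠ 0) :
    Fop V ψ x = gradDot V ψ x + lap V x * ψ x -
      ((marg (pd (e1 m) (fun x => pd (e1 m) V x * ψ x)) x.1 * marg ψ x.1 -
      marg (fun x => pd (e1 m) V x * ψ x) x.1 * marg (pd (e1 m) ψ) x.1)
        * ((marg ψ x.1)⁻¹ * (marg ψ x.1)⁻¹) * ψ x +
      marg (fun x => pd (e1 m) V x * ψ x) x.1 * (marg ψ x.1)⁻¹ * pd (e1 m) ψ x) := by
  have h := (phi_mul_fderiv (phi_deriv hV hψ ht) hψ.diff).fderiv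
  rw [Fop]
  congr 1
  rw [pd, h]
  have hp : phiF V ψ x.1 = marg (fun x => pd (e1 m) V x * ψ x) x.1 / marg ψ x.1 := rfl
  simp only [_root_.add_apply, _root_.smul_apply, smul_eq_mul,
    ContinuousLinearMap.coe_fst', hp]
  have : (e1 m).1 = 1 := rfl
  rw [this, pd, div_eq_mul_inv, div_eq_mul_inv, ← inv_pow]
  ring

lemma main_est {m : ℕ} {V : Spc m → ℝ} (hV : ContDiff ℝ 2 V) (hVper : IsPeriodic V)
    (B δ : ℝ) (hδ : 0 < δ) :
    ∃ L : ℝ, 0 < L ∧ ∀ E : ℝ, 0 ≤ E → ∀ ψ1 ψ2 : Spc m → ℝ, Nice B ψ1 → Nice B ψ2 →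
      Nice E (fun x => ψ1 x - ψ2 x) → (∀ t, δ ≤ marg ψ1 t) → (∀ t, δ ≤ marg ψ2 t) →
      ∀ x, |Fop V ψ1 x| ≤ L ∧ |Fop V ψ1 x - Fop V ψ2 x| ≤ L * E := by
  obtain ⟨A, hA1, hAC⟩ := V_nice_all hV hVper
  have main : ∃ B' L' : ℝ, ∀ E : ℝ, 0 ≤ E → ∀ ψ1 ψ2 : Spc m → ℝ, Nice B ψ1 → Nice B ψ2 →
      Nice E (fun x => ψ1 x - ψ2 x) → (∀ t, δ ≤ marg ψ1 t) → (∀ t, δ ≤ marg ψ2 t) →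
      ∀ x, LB E (Fop V ψ1 x) (Fop V ψ2 x) B' L' := by
    refine ⟨?_, ?_, fun E hE ψ1 ψ2 h1 h2 hd m1 m2 x => ?_⟩
    rotate_left 2
    · rw [Fop_eq hA1 h1 x (hδ.trans_le (m1 _)).ne', Fop_eq hA1 h2 x (hδ.trans_le (m2 _)).ne']
      have hd' : Nice (1 * E) (fun x => ψ1 x - ψ2 x) := by rwa [one_mul]
      have hdV : Nice ((2 * A) * E) (fun x => pd (e1 m) V x * ψ1 x - pd (e1 m) V x * ψ2 x) := by
        have := hA1.mul hd
        simpa only [mul_sub] using this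
      have hψ := val_LB h1 h2 hd' x
      have hb := marg_LB h1 h2 hd' x.1
      have hb' := marg_pd_LB h1 h2 hd' x.1
      have ha := marg_LB (hA1.mul h1) (hA1.mul h2) hdV x.1
      have ha' := marg_pd_LB (hA1.mul h1) (hA1.mul h2) hdV x.1
      have hi := hb.inv hδ (m1 _) (m2 _)
      have hp1 := pd_LB h1 h2 hd' (norm_e1 m) x
      have hg : LB E (gradDot V ψ1 x) (gradDot V ψ2 x) _ _ :=
        ((LB.const (hA1.bd x)).mul hp1).add
          (LB.sum fun i => (LB.const ((hAC i).bd x)).mul (pd_LB h1 h2 hd' (norm_eC m i) x))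
      have hl : LB E (lap V x) (lap V x) _ _ :=
        (LB.const (hA1.pd_le (norm_e1 m) x)).add
          (LB.sum fun i => LB.const ((hAC i).pd_le (norm_eC m i) x))
      exact (hg.add (hl.mul hψ)).sub
        (((((ha'.mul hb).sub (ha.mul hb')).mul (hi.mul hi)).mul hψ).add ((ha.mul hi).mul hp1))
  obtain ⟨B', L', h⟩ := main
  refine ⟨|B'| + |L'| + 1, by positivity, fun E hE ψ1 ψ2 h1 h2 hd m1 m2 x => ?_⟩
  obtain ⟨a, b, c⟩ := h E hE ψ1 ψ2 h1 h2 hd m1 m2 x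
  have e1 := le_abs_self B'
  have e2 := le_abs_self L'
  have e3 := abs_nonneg B'
  have e4 := abs_nonneg L'
  refine ⟨by linarith, c.trans ?_⟩
  gcongr
  linarith

lemma marg_per {m : ℕ} {h : Spc m → ℝ} (hh : IsPeriodic h) (t : ℝ) (k : ℤ) :
    marg h (t + k) = marg h t := by
  unfold marg
  congr 1
  funext y
  simpa using hh (t, y) k 0

lemma per_mul {m : ℕ} {f g : Spc m → ℝ} (hf : IsPeriodic f) (hg : IsPeriodic g) :
    IsPeriodic (fun x => f x * g x) := fun x k j => by simp only [hf x k j, hg x k j]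

lemma phi_per {m : ℕ} {V ψ : Spc m → ℝ} (hV : IsPeriodic V) (hψ : IsPeriodic ψ) (t : ℝ) (k : ℤ) :
    phiF V ψ (t + k) = phiF V ψ t := by
  have h1 := marg_per (per_mul (pd_per hV (e1 m)) hψ) t k
  have h2 := marg_per hψ t k
  unfold marg at h1
  unfold phiF
  rw [h1, h2]

/-- the flux -/
def flux {m : ℕ} (V ψ : Spc m → ℝ) : Fin (m+1) → Spc m → ℝ :=
  Fin.cons (fun x => pd (e1 m) V x * ψ x - phiF V ψ x.1 * ψ x)
    (fun i x => pd (eC m i) V x * ψ x)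

lemma flux_per {m : ℕ} {V ψ : Spc m → ℝ} (hV : IsPeriodic V) (hψ : IsPeriodic ψ) (i : Fin (m+1)) :
    IsPeriodic (flux V ψ i) := by
  refine Fin.cases ?_ (fun i => ?_) i
  · intro x k j
    simp only [flux, Fin.cons_zero, hψ x k j, pd_per hV (e1 m) x k j, phi_per hV hψ]
  · exact per_mul (pd_per hV _) hψ

lemma flux_diff {m : ℕ} {A B : ℝ} {V ψ : Spc m → ℝ} (hA1 : Nice A (pd (e1 m) V))
    (hAC : ∀ i, Nice A (pd (eC m i) V)) (hψ : Nice B ψ) (hm : ∀ t, marg ψ t ≠ 0) (i : Fin (m+1)) :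
    Differentiable ℝ (flux V ψ i) := by
  refine Fin.cases ?_ (fun i => ?_) i
  · exact (hA1.diff.mul hψ.diff).sub
      fun x => (phi_mul_fderiv (phi_deriv hA1 hψ (hm x.1)) hψ.diff).differentiableAt
  · exact (hAC i).diff.mul hψ.diff

lemma pd_mul {m : ℕ} {f g : Spc m → ℝ} (hf : Differentiable ℝ f) (hg : Differentiable ℝ g)
    (v x : Spc m) : fderiv ℝ (fun x => f x * g x) x v = f x * pd v g x + g x * pd v f x := by
  rw [fderiv_fun_mul (hf x) (hg x)]; rfl

lemma div_flux {m : ℕ} {A B : ℝ} {V ψ : Spc m → ℝ} (hA1 : Nice A (pd (e1 m) V))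
    (hAC : ∀ i, Nice A (pd (eC m i) V)) (hψ : Nice B ψ) (hm : ∀ t, marg ψ t ≠ 0) (x : Spc m) :
    Fop V ψ x = fderiv ℝ (flux V ψ 0) x (e1 m) + ∑ i : Fin m, fderiv ℝ (flux V ψ i.succ) x (eC m i) := by
  have h0 : fderiv ℝ (flux V ψ 0) x (e1 m) = pd (e1 m) V x * pd (e1 m) ψ x +
      ψ x * pd (e1 m) (pd (e1 m) V) x - pd (e1 m) (fun z => phiF V ψ z.1 * ψ z) x := by
    rw [← pd_mul hA1.diff hψ.diff]
    change fderiv ℝ (fun x => pd (e1 m) V x * ψ x - phiF V ψ x.1 * ψ x) x (e1 m) = _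
    rw [fderiv_fun_sub ((hA1.mul hψ).diff x)
      (phi_mul_fderiv (phi_deriv hA1 hψ (hm x.1)) hψ.diff).differentiableAt]
    rfl
  have h1 : ∀ i : Fin m, fderiv ℝ (flux V ψ i.succ) x (eC m i) = pd (eC m i) V x * pd (eC m i) ψ x +
      ψ x * pd (eC m i) (pd (eC m i) V) x := fun i => pd_mul (hAC i).diff hψ.diff _ _
  simp only [h0, h1, Finset.sum_add_distrib, ← Finset.mul_sum, Fop, gradDot, lap]
  ring

lemma Fop_meas {m : ℕ} {V ψ : Spc m → ℝ} (hψ : Measurable ψ) : Measurable (Fop V ψ) := by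
  unfold Fop gradDot lap
  have := fun v (f : Spc m → ℝ) => pd_meas v f
  refine Measurable.sub (Measurable.add (Measurable.add ((this _ _).mul (this _ _)) ?_) (Measurable.mul (Measurable.add (this _ _) ?_) hψ)) (this _ _)
  · exact Finset.measurable_sum _ fun i _ => (this _ _).mul (this _ _)
  · exact Finset.measurable_sum _ fun i _ => this _ _

lemma cube_ae (m : ℕ) : (cube m : Set (Spc m)) =ᵐ[volume] Icc (0 : Spc m) 1 := by
  have h1 : (Icc (0 : Spc m) 1) = Icc (0:ℝ) 1 ×ˢ Icc (0 : Fin m → ℝ) 1 := by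
    rw [Icc_prod_eq]; rfl
  rw [h1, cube, Measure.volume_eq_prod]
  refine Measure.set_prod_ae_eq Ico_ae_eq_Icc ?_
  exact Measure.univ_pi_Ico_ae_eq_Icc (μ := fun _ : Fin m => (volume : Measure ℝ)) (f := 0) (g := 1)

lemma mean_zero {m : ℕ} {A B L : ℝ} {V ψ : Spc m → ℝ} (hVper : IsPeriodic V) (hψper : IsPeriodic ψ)
    (hA1 : Nice A (pd (e1 m) V))
    (hAC : ∀ i, Nice A (pd (eC m i) V)) (hψ : Nice B ψ) (hm : ∀ t, marg ψ t ≠ 0)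
    (hb : ∀ x, |Fop V ψ x| ≤ L) :
    (∫ x in cube m, Fop V ψ x) = 0 := by
  rw [setIntegral_congr_set (cube_ae m)]
  let eL : Spc m ≃L[ℝ] (Fin (m+1) → ℝ) := Fin.consEquivL ℝ (fun _ => ℝ)
  have eL_apply : ∀ x : Spc m, eL x = Fin.cons x.1 x.2 := fun x => rfl
  have eL_symm : ∀ z, eL.symm z = (z 0, fun i => z i.succ) := fun z => rfl
  have hd := flux_diff hA1 hAC hψ hm
  rw [integral_divergence_of_hasFDerivAt_off_countable_of_equiv eL ?_ ?_ (flux V ψ)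
    (fun i x => fderiv ℝ (flux V ψ i) x) ∅ countable_empty 0 1 zero_le_one
    (fun i => (hd i).continuous.continuousOn) (fun x _ i => (hd i x).hasFDerivAt) (Fop V ψ) ?_ ?_]
  · refine Finset.sum_eq_zero fun i _ => ?_
    rw [sub_eq_zero]
    congr 1
    funext x
    have h0 : eL 0 i = 0 := by simp
    have h1 : eL 1 i = 1 := by
      rw [eL_apply]
      refine Fin.cases ?_ (fun i => ?_) i <;> simp
    rw [h0, h1]
    have hp := flux_per hVper hψper i (eL.symm (i.insertNth 0 x)) ((Pi.single i 1 : Fin (m+1) → ℤ) 0)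
      (fun l => (Pi.single i 1 : Fin (m+1) → ℤ) l.succ)
    rw [← hp]
    congr 1
    have e : ∀ l : Fin (m+1), (i.insertNth (1:ℝ) x : Fin (m+1) → ℝ) l =
        (i.insertNth (0:ℝ) x : Fin (m+1) → ℝ) l + (((Pi.single i 1 : Fin (m+1) → ℤ) l : ℤ) : ℝ) := by
      intro l
      refine Fin.succAboveCases i ?_ (fun l => ?_) l
      · simp
      · simp [Fin.succAbove_ne]
    rw [eL_symm, eL_symm]
    ext
    · exact e 0
    · exact e _
  · intro x y
    rw [eL_apply, eL_apply, Fin.cons_le_cons]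
    rfl
  · have hv := (volume_preserving_piFinSuccAbove (fun _ : Fin (m+1) => ℝ) 0).symm
    have he : (⇑(MeasurableEquiv.piFinSuccAbove (fun _ : Fin (m+1) => ℝ) 0).symm) = ⇑eL := by
      funext x
      rw [eL_apply]
      simp [MeasurableEquiv.piFinSuccAbove]
      rfl
    rw [← he]; exact hv
  · intro x
    rw [div_flux hA1 hAC hψ hm, Fin.sum_univ_succ]
    have a0 : eL.symm (Pi.single 0 1) = e1 m := by
      rw [eL_symm]; ext <;> simp [e1]
    have a1 : ∀ i : Fin m, eL.symm (Pi.single i.succ 1) = eC m i := by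
      intro i
      rw [eL_symm]
      ext l
      · simp [eC]
      · simp [eC, Pi.single_apply]
    simp only [a0, a1]
  · refine Measure.integrableOn_of_bounded (M := L) ?_ 
      (Fop_meas hψ.diff.continuous.measurable).aestronglyMeasurable
      (Eventually.of_forall hb)
    rw [← measure_congr (cube_ae m), vol_cube]; simp

lemma LpN_le {m : ℕ} {p : ℝ} {f : Spc m → ℝ} {C : ℝ} (h : ∀ x, |f x| ≤ C) :
    LpN p f ≤ ENNReal.ofReal C := by
  have := eLpNorm_le_of_ae_bound (p := ENNReal.ofReal p) (μ := μT m) (f := f) (C := C)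
    (Eventually.of_forall h)
  simpa [LpN] using this

lemma marg_lower {m : ℕ} {B : ℝ} {ψ : Spc m → ℝ} (hψ : Nice B ψ) (hper : IsPeriodic ψ)
    (hpos : ∀ t, 0 < marg ψ t) : ∃ δ : ℝ, 0 < δ ∧ ∀ t, δ ≤ marg ψ t := by
  have hc : Continuous (marg ψ) :=
    continuous_iff_continuousAt.2 fun t => (marg_deriv hψ t).continuousAt
  obtain ⟨t0, _, h⟩ := (isCompact_Icc (a := (0:ℝ)) (b := 1)).exists_isMinOn
    (nonempty_Icc.2 zero_le_one) hc.continuousOn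
  refine ⟨marg ψ t0, hpos t0, fun t => ?_⟩
  have e : marg ψ t = marg ψ (Int.fract t) := by
    rw [← marg_per hper (Int.fract t) ⌊t⌋, Int.fract_add_floor]
  rw [e]
  exact h ⟨Int.fract_nonneg t, (Int.fract_lt_one t).le⟩


/-- **`F` is well defined and locally Lipschitz (Lemma `lips`).** Assume `[H₂]`. Then
`F : 𝒟^{σ,p}(𝕋ⁿ) → L^p₀(𝕋ⁿ)` is well defined, and for every `ψ ∈ 𝒟^{σ,p}(𝕋ⁿ)` there exist
`R > 0`, `L > 0` such that for all `ψ₁, ψ₂` in the `W^{σ,p}`-ball of radius `R` around `ψ`,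
`‖F(ψ₁) − F(ψ₂)‖_{L^p} ≤ L ‖ψ₁ − ψ₂‖_{W^{σ,p}}`. -/
theorem F_well_defined_and_locally_lipschitz
    (m : ℕ) (V : Spc m → ℝ) (σ p : ℝ)
    (hV : ContDiff ℝ 2 V) (hVper : IsPeriodic V) (h2 : Hyp2 m σ p) :
    (∀ ψ : Spc m → ℝ, MemD σ p ψ →
      LpN p (Fop V ψ) < ⊤ ∧ (∫ x in cube m, Fop V ψ x) = 0) ∧
    ∀ ψ : Spc m → ℝ, MemD σ p ψ →
      ∃ R L : ℝ, 0 < R ∧ 0 < L ∧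
        ∀ ψ1 ψ2 : Spc m → ℝ, MemW σ p ψ1 → MemW σ p ψ2 →
          WNorm σ p (fun x => ψ1 x - ψ x) ≤ ENNReal.ofReal R →
          WNorm σ p (fun x => ψ2 x - ψ x) ≤ ENNReal.ofReal R →
          LpN p (fun x => Fop V ψ1 x - Fop V ψ2 x) ≤
            ENNReal.ofReal L * WNorm σ p (fun x => ψ1 x - ψ2 x) := by
  obtain ⟨C, hC, hkey⟩ := key h2
  have hσ : 1 ≤ σ := by
    obtain ⟨_, hp, h3, h4⟩ := h2
    have hp0 : 0 < p := lt_trans (by positivity) hp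
    have : 0 < ((m : ℝ) + 1) / p := by positivity
    linarith
  have nice : ∀ f : Spc m → ℝ, MemW σ p f → Nice (C * (WNorm σ p f).toReal) f := fun f hf =>
    ⟨hf.2.2.1 hσ, fun x => (hkey f hf x).1, fun x => (hkey f hf x).2⟩
  have memsub : ∀ f g : Spc m → ℝ, MemW σ p f → MemW σ p g →
      WNorm σ p (fun x => f x - g x) < ⊤ → MemW σ p (fun x => f x - g x) := by
    intro f g hf hg h
    refine ⟨fun x k j => by simp only [hf.1 x k j, hg.1 x k j], hf.2.1.sub hg.2.1,
      fun _ => (hf.2.2.1 hσ).sub (hg.2.2.1 hσ), fun h' => ?_, h⟩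
    exact absurd h' (not_le.2 h2.2.2.2)
  obtain ⟨A, hA1, hAC⟩ := V_nice_all hV hVper
  refine ⟨fun ψ hψ => ?_, fun ψ hψ => ?_⟩
  · have hN := nice ψ hψ.1
    obtain ⟨δ, hδ, hm⟩ := marg_lower hN hψ.1.1 hψ.2
    obtain ⟨L, hL, hest⟩ := main_est hV hVper _ δ hδ
    have hz : Nice 0 (fun x => ψ x - ψ x) := by
      simp only [sub_self]
      exact ⟨differentiable_const _, fun x => by simp, fun x => by simp⟩
    have hb := fun x => (hest 0 le_rfl ψ ψ hN hN hz hm hm x).1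
    exact ⟨(LpN_le hb).trans_lt ENNReal.ofReal_lt_top,
      mean_zero hVper hψ.1.1 hA1 hAC hN (fun t => (hψ.2 t).ne') hb⟩
  · have hN := nice ψ hψ.1
    obtain ⟨δ, hδ, hm⟩ := marg_lower hN hψ.1.1 hψ.2
    set B0 := C * (WNorm σ p ψ).toReal with hB0
    obtain ⟨L, hL, hest⟩ := main_est hV hVper (B0 + δ / 2) (δ / 2) (by positivity)
    have hball : ∀ f : Spc m → ℝ, MemW σ p f →
        WNorm σ p (fun x => f x - ψ x) ≤ ENNReal.ofReal (δ / 2 / C) →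
        Nice (B0 + δ / 2) f ∧ ∀ t, δ / 2 ≤ marg f t := by
      intro f hf hfW
      have hd := nice _ (memsub f ψ hf hψ.1 (hfW.trans_lt ENNReal.ofReal_lt_top))
      have hle : C * (WNorm σ p (fun x => f x - ψ x)).toReal ≤ δ / 2 := by
        have := ENNReal.toReal_le_of_le_ofReal (by positivity) hfW
        calc _ ≤ C * (δ / 2 / C) := by gcongr
          _ = _ := by field_simp
      replace hd := hd.mono hle
      have hfd := hf.2.2.1 hσ
      have hfN : Nice (B0 + δ / 2) f := by
        refine ⟨hfd, fun x => ?_, fun x => ?_⟩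
        · have h1 := hd.bd x
          have h3 := hN.bd x
          have h4 := abs_add_le (ψ x) (f x - ψ x)
          rw [add_sub_cancel] at h4
          linarith
        · have h1 := hd.bd' x
          have h3 := hN.bd' x
          rw [fderiv_fun_sub (hfd x) (hN.diff x)] at h1
          have h4 := norm_add_le (fderiv ℝ ψ x) (fderiv ℝ f x - fderiv ℝ ψ x)
          rw [add_sub_cancel] at h4
          linarith
      refine ⟨hfN, fun t => ?_⟩
      have h1 := marg_sub hfd.continuous.measurable hfN.bd hN.diff.continuous.measurable
        (hN.mono (by linarith : B0 ≤ B0 + δ / 2)).bd t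
      have h3 := marg_abs_le hd.bd t
      rw [← h1, abs_le] at h3
      linarith [hm t]
    refine ⟨δ / 2 / C, L * C, by positivity, by positivity, fun ψ1 ψ2 h1 h2' hR1 hR2 => ?_⟩
    obtain ⟨n1, m1⟩ := hball ψ1 h1 hR1
    obtain ⟨n2, m2⟩ := hball ψ2 h2' hR2
    rcases eq_or_ne (WNorm σ p (fun x => ψ1 x - ψ2 x)) ⊤ with htop | htop
    · rw [htop, ENNReal.mul_top (by simpa using mul_pos hL hC)]
      exact le_top
    · have hd := nice _ (memsub ψ1 ψ2 h1 h2' htop.lt_top)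
      have := LpN_le (p := p) fun x => (hest _ (by positivity) ψ1 ψ2 n1 n2 hd m1 m2 x).2
      refine this.trans (le_of_eq ?_)
      rw [← mul_assoc, ENNReal.ofReal_mul (by positivity), ENNReal.ofReal_toReal htop]
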